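/- Let F be a finite field with q elements and let C ⊆ F^n be a linear subspace containing a nonzero vector, with minimum distance d := d(C). Then every matrix M ∈ C⊗C whose rank is at least 2 satisfies q·‖M‖₀ ≥ (q+1)·d². -/

import Mathlib

open Matrix

noncomputable section

/-- Hamming weight of a vector: number of nonzero coordinates. -/
def hw {F : Type*} [Zero F] {n : ℕ} (x : Fin n → F) : ℕ :=
  (Function.support x).ncard

/-- Hamming weight of a matrix: number of nonzero entries. -/
def hwM {F : Type*} [Zero F] {n m : ℕ} (M : Matrix (Fin n) (Fin m) F) : ℕ :=
  (Function.support fun p : Fin n × Fin m => M p.1 p.2).ncard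

/-- Minimum distance of a linear code. -/
def dmin {F : Type*} [Field F] {n : ℕ} (C : Submodule F (Fin n → F)) : ℕ :=
  sInf {w | ∃ u ∈ C, u ≠ 0 ∧ hw u = w}

/-- Tensor code: matrices whose columns lie in `U` and rows lie in `V`. -/
def tensorCode {F : Type*} [Field F] {n m : ℕ} (U : Submodule F (Fin n → F))
    (V : Submodule F (Fin m → F)) : Set (Matrix (Fin n) (Fin m) F) :=
  {M | (∀ j, (fun i => M i j) ∈ U) ∧ ∀ i, (fun j => M i j) ∈ V}

open scoped Classical in
lemma hw_eq_sum {F : Type*} [Zero F] {n : ℕ} (x : Fin n → F) :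
    hw x = ∑ i, if x i = 0 then 0 else 1 := by
  have h : Function.support x = ↑(Finset.univ.filter fun i => x i ≠ 0) := by
    ext i; simp
  rw [hw, h, Set.ncard_coe_finset, Finset.card_filter]
  exact Finset.sum_congr rfl fun i _ => by by_cases hi : x i = 0 <;> simp [hi]

/-- The weight of a matrix is the sum of the weights of its columns. -/
lemma hwM_eq_sum_hw_col {F : Type*} [Zero F] {n m : ℕ} (M : Matrix (Fin n) (Fin m) F) :
    hwM M = ∑ j, hw fun i => M i j := by
  classical
  have h : (Function.support fun p : Fin n × Fin m => M p.1 p.2) =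
      ↑(Finset.univ.filter fun p : Fin n × Fin m => M p.1 p.2 ≠ 0) := by
    ext p; simp
  rw [hwM, h, Set.ncard_coe_finset, Finset.card_filter, Fintype.sum_prod_type_right]
  refine Finset.sum_congr rfl fun j _ => ?_
  rw [hw_eq_sum]
  exact Finset.sum_congr rfl fun i _ => by by_cases hi : M i j = 0 <;> simp [hi]

lemma dmin_le_hw {F : Type*} [Field F] {n : ℕ} {C : Submodule F (Fin n → F)} {u : Fin n → F}
    (hu : u ∈ C) (h0 : u ≠ 0) : dmin C ≤ hw u :=
  Nat.sInf_le ⟨u, hu, h0, rfl⟩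

open scoped Classical in
/-- Among the `q + 1` points `y` and `x + a * y` of a pencil, at most `q` are nonzero. -/
lemma pencil_count_le {F : Type*} [Field F] [Fintype F] (x y : F) :
    (if y = 0 then 0 else 1) + ∑ a : F, (if x + a * y = 0 then 0 else 1) ≤ Fintype.card F := by
  by_cases hy : y = 0
  · subst hy
    by_cases hx : x = 0 <;> simp [hx]
  · have hlt : ∑ a : F, (if x + a * y = 0 then 0 else 1) < ∑ _a : F, 1 := by
      refine Finset.sum_lt_sum (fun a _ => by split_ifs <;> simp) ⟨-x / y, Finset.mem_univ _, ?_⟩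
      have h : x + -x / y * y = 0 := by field_simp; ring
      simp [h]
    simp only [hy, if_false]
    simp only [Finset.sum_const, Finset.card_univ, smul_eq_mul, mul_one] at hlt
    omega

open scoped Classical in
/-- Griesmer-type bound for the support of the span of two independent words. -/
lemma succ_card_mul_dmin_le {F : Type*} [Field F] [Fintype F] {n : ℕ}
    {C : Submodule F (Fin n → F)} {u v : Fin n → F} (hu : u ∈ C) (hv : v ∈ C) (hv0 : v ≠ 0)
    (huv : u ∉ Submodule.span F {v}) :
    (Fintype.card F + 1) * dmin C ≤
      Fintype.card F * (Finset.univ.filter fun j => u j ≠ 0 ∨ v j ≠ 0).card := by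
  have h1 : ∀ a : F, dmin C ≤ hw (u + a • v) := fun a =>
    dmin_le_hw (C.add_mem hu (C.smul_mem a hv)) fun h =>
      huv (Submodule.mem_span_singleton.2 ⟨-a, by
        rw [neg_smul]; exact (eq_neg_of_add_eq_zero_left h).symm⟩)
  calc (Fintype.card F + 1) * dmin C = dmin C + ∑ _a : F, dmin C := by
        simp only [Finset.sum_const, Finset.card_univ, smul_eq_mul]; ring
    _ ≤ hw v + ∑ a : F, hw (u + a • v) :=
        add_le_add (dmin_le_hw hv hv0) (Finset.sum_le_sum fun a _ => h1 a)
    _ = ∑ j, ((if v j = 0 then 0 else 1) + ∑ a : F, (if u j + a * v j = 0 then 0 else 1)) := by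
        simp only [hw_eq_sum, Pi.add_apply, Pi.smul_apply, smul_eq_mul]
        rw [Finset.sum_comm, Finset.sum_add_distrib]
    _ ≤ ∑ j, if u j ≠ 0 ∨ v j ≠ 0 then Fintype.card F else 0 := by
        refine Finset.sum_le_sum fun j _ => ?_
        by_cases h : u j ≠ 0 ∨ v j ≠ 0
        · rw [if_pos h]
          exact pencil_count_le (u j) (v j)
        · simp_all
    _ = _ := by rw [← Finset.sum_filter, Finset.sum_const, smul_eq_mul, mul_comm]

/-- A matrix of rank at least two has two independent rows. -/
lemma exists_row_notMem_span {F : Type*} [Field F] {n m : ℕ} (M : Matrix (Fin n) (Fin m) F)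
    (hrank : 2 ≤ M.rank) : ∃ i k, M i ≠ 0 ∧ M k ∉ Submodule.span F {M i} := by
  have h0 : ∃ i, M i ≠ 0 := by
    by_contra! h
    have : M = 0 := funext h
    simp [this] at hrank
  obtain ⟨i, hi⟩ := h0
  refine ⟨i, ?_⟩
  by_contra! h
  have hle : Submodule.span F (Set.range M) ≤ Submodule.span F {M i} :=
    Submodule.span_le.2 (by rintro _ ⟨k, rfl⟩; exact h k hi)
  have h2 := Submodule.finrank_mono hle
  have h3 := M.rank_eq_finrank_span_row
  have h4 := finrank_span_singleton (K := F) hi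
  change M.rank = Module.finrank F (Submodule.span F (Set.range M)) at h3
  omega

theorem stmt4 {F : Type*} [Field F] [Fintype F] {q n : ℕ}
    (hq : Fintype.card F = q) (C : Submodule F (Fin n → F))
    (hC : ∃ u ∈ C, u ≠ 0)
    (M : Matrix (Fin n) (Fin n) F) (hM : M ∈ tensorCode C C)
    (hrank : 2 ≤ M.rank) :
    (q + 1) * dmin C ^ 2 ≤ q * hwM M := by
  classical
  subst hq
  obtain ⟨i, k, hi, hk⟩ := exists_row_notMem_span M hrank
  have hS := succ_card_mul_dmin_le (hM.2 k) (hM.2 i) hi hk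
  set S := Finset.univ.filter fun j => M k j ≠ 0 ∨ M i j ≠ 0 with hSdef
  have hcol : S.card * dmin C ≤ hwM M := by
    rw [hwM_eq_sum_hw_col, ← smul_eq_mul, ← Finset.sum_const]
    refine (Finset.sum_le_sum fun j hj => dmin_le_hw (hM.1 j) fun h => ?_).trans
      (Finset.sum_le_sum_of_subset (Finset.subset_univ S))
    rcases (Finset.mem_filter.1 hj).2 with h' | h'
    · exact h' (congrFun h k)
    · exact h' (congrFun h i)
  calc (Fintype.card F + 1) * dmin C ^ 2 = (Fintype.card F + 1) * dmin C * dmin C := by ring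
    _ ≤ Fintype.card F * S.card * dmin C := Nat.mul_le_mul_right _ hS
    _ = Fintype.card F * (S.card * dmin C) := mul_assoc _ _ _
    _ ≤ Fintype.card F * hwM M := Nat.mul_le_mul_left _ hcol
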